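/- Let k ≥ 0, let γ : Fin k → I, let β ∈ I, and let m be an integer with m ≥ 0. Then for every (r,s) ∈ ℤ^k × ℤ with r(0)+⋯+r(k−1)+s = m one has (−s)·a*(γ(0),r(0))⋯a*(γ(k−1),r(k−1))·a*(β,s)·u_n = 0 in M_n; in particular this family has finite support and sums to 0. (This is the vanishing on the vacuum of the m-th Fourier mode of Q̃(a*(z))·∂_z a*_β(z) for any polynomial Q̃ in the fields a*_γ(z), where ∂_z a*_β(z) = ∑_s (−s)·a*(β,s) z^{−s−1}; it is used in the proofs of the corollary f_{α,0}·u_n = 0 and of the Verma-to-Wakimoto morphism.) -/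

import Mathlib

noncomputable section

/-- Generators of the infinite-dimensional Weyl algebra: `a γ r` and `as γ r`
(the latter playing the role of `a*(γ,r)`), for `γ ∈ I`, `r ∈ ℤ`. -/
inductive WGen (I : Type) : Type
  | a : I → ℤ → WGen I
  | as : I → ℤ → WGen I

open FreeAlgebra in
/-- The defining relations of the infinite-dimensional Weyl algebra `𝒜`:
`a(γ,r)·a*(δ,s) − a*(δ,s)·a(γ,r) = (1 if γ = δ and r = −s, else 0)`, while the `a`'s
commute among themselves and the `a*`'s commute among themselves. -/
inductive WeylRel (I : Type) : FreeAlgebra ℂ (WGen I) → FreeAlgebra ℂ (WGen I) → Prop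
  | a_as_eq (γ : I) (r : ℤ) :
      WeylRel I (ι ℂ (WGen.a γ r) * ι ℂ (WGen.as γ (-r)))
        (ι ℂ (WGen.as γ (-r)) * ι ℂ (WGen.a γ r) + 1)
  | a_as_ne (γ δ : I) (r s : ℤ) (h : γ ≠ δ ∨ r ≠ -s) :
      WeylRel I (ι ℂ (WGen.a γ r) * ι ℂ (WGen.as δ s))
        (ι ℂ (WGen.as δ s) * ι ℂ (WGen.a γ r))
  | a_a (γ δ : I) (r s : ℤ) :
      WeylRel I (ι ℂ (WGen.a γ r) * ι ℂ (WGen.a δ s))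
        (ι ℂ (WGen.a δ s) * ι ℂ (WGen.a γ r))
  | as_as (γ δ : I) (r s : ℤ) :
      WeylRel I (ι ℂ (WGen.as γ r) * ι ℂ (WGen.as δ s))
        (ι ℂ (WGen.as δ s) * ι ℂ (WGen.as γ r))

/-- The infinite-dimensional Weyl algebra `𝒜`: the quotient of the free ℂ-algebra on
the generators `a(γ,r)`, `a*(γ,r)` by the two-sided ideal generated by the relations. -/
abbrev WeylAlg (I : Type) : Type := RingQuot (WeylRel I)

/-- The generator `a(γ,r)` of `𝒜`. -/
def wa {I : Type} (γ : I) (r : ℤ) : WeylAlg I :=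
  RingQuot.mkAlgHom ℂ (WeylRel I) (FreeAlgebra.ι ℂ (WGen.a γ r))

/-- The generator `a*(γ,r)` of `𝒜`. -/
def was {I : Type} (γ : I) (r : ℤ) : WeylAlg I :=
  RingQuot.mkAlgHom ℂ (WeylRel I) (FreeAlgebra.ι ℂ (WGen.as γ r))

/-- The left ideal of `𝒜` generated by the `a(γ,r)` with `r ≥ n` and the
`a*(γ,r)` with `r ≥ 1 − n`. -/
def fockIdeal (I : Type) (n : ℕ) : Submodule (WeylAlg I) (WeylAlg I) :=
  Submodule.span (WeylAlg I)
    ({x | ∃ γ : I, ∃ r : ℤ, (n : ℤ) ≤ r ∧ x = wa γ r} ∪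
     {x | ∃ γ : I, ∃ r : ℤ, 1 - (n : ℤ) ≤ r ∧ x = was γ r})

/-- The Fock module `M_n = 𝒜 / 𝒜·(a(γ,r) : r ≥ n, a*(γ,r) : r ≥ 1−n)`,
a left `𝒜`-module. -/
abbrev Fock (I : Type) (n : ℕ) : Type := WeylAlg I ⧸ fockIdeal I n

/-- The vacuum vector `u_n ∈ M_n`, the image of `1 ∈ 𝒜`. -/
def fockVac (I : Type) (n : ℕ) : Fock I n := Submodule.Quotient.mk 1


theorem was_commute {I : Type} (γ δ : I) (r s : ℤ) : Commute (was γ r) (was δ s) := by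
  simpa [Commute, SemiconjBy, was] using RingQuot.mkAlgHom_rel ℂ (WeylRel.as_as γ δ r s)

/-- A product of `a*`-generators, at least one of which annihilates the vacuum, lies in the
left ideal defining the Fock module. -/
theorem prod_was_mem_fockIdeal {I : Type} {n : ℕ} (l : List (I × ℤ)) {p : I × ℤ} (hp : p ∈ l)
    (h : 1 - (n : ℤ) ≤ p.2) : (l.map fun q => was q.1 q.2).prod ∈ fockIdeal I n := by
  induction l with
  | nil => simp at hp
  | cons q l ih =>
    rw [List.map_cons, List.prod_cons]
    rcases List.mem_cons.1 hp with rfl | hl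
    · have hc : Commute (was p.1 p.2) (l.map fun q => was q.1 q.2).prod := by
        refine Commute.list_prod_right _ _ fun x hx => ?_
        obtain ⟨q, -, rfl⟩ := List.mem_map.1 hx
        exact was_commute _ _ _ _
      rw [hc.eq]
      exact Submodule.smul_mem _ _ (Submodule.subset_span (Or.inr ⟨p.1, p.2, h, rfl⟩))
    · exact Submodule.smul_mem _ _ (ih hl)

theorem smul_fockVac_eq_zero {I : Type} {n : ℕ} {x : WeylAlg I} (hx : x ∈ fockIdeal I n) :
    x • fockVac I n = 0 := by
  rw [fockVac, ← Submodule.Quotient.mk_smul, smul_eq_mul, mul_one]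
  exact (Submodule.Quotient.mk_eq_zero _).2 hx

/-- A monomial in the `a*`-generators of nonnegative total degree annihilates the vacuum. -/
theorem prod_was_mul_was_smul_fockVac {I : Type} {n k : ℕ} (hn : 1 ≤ n) (γ : Fin k → I) (β : I)
    (r : Fin k → ℤ) (s : ℤ) (h : 0 ≤ (∑ i, r i) + s) :
    ((List.ofFn fun i => was (γ i) (r i)).prod * was β s) • fockVac I n = 0 := by
  apply smul_fockVac_eq_zero
  have key : ∃ p ∈ (List.ofFn fun i => (γ i, r i)) ++ [(β, s)], 1 - (n : ℤ) ≤ p.2 := by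
    by_cases hs : 0 ≤ s
    · exact ⟨(β, s), by simp, by dsimp only; lia⟩
    · obtain ⟨i, -, hi⟩ := Finset.exists_lt_of_sum_lt (s := Finset.univ) (f := fun _ => (0 : ℤ))
        (g := r) (by rw [Finset.sum_const_zero]; lia)
      exact ⟨(γ i, r i), List.mem_append_left _ (List.mem_ofFn.2 ⟨i, rfl⟩), by dsimp only; lia⟩
  obtain ⟨p, hp, hle⟩ := key
  simpa [List.map_ofFn, Function.comp_def] using prod_was_mem_fockIdeal _ hp hle

/-!
STATEMENT 6: for `k ≥ 0`, `γ : Fin k → I`, `β ∈ I` and any integer `m ≥ 0`, every term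
`(−s)·a*(γ 0, r 0)⋯a*(γ (k−1), r (k−1))·a*(β,s)·u_n` with `r 0 + ⋯ + r (k−1) + s = m`
vanishes in `M_n`; in particular this family has finite support and sums to `0`.
(This is the vanishing on the vacuum of the `m`-th Fourier mode of
`Q̃(a*(z))·∂_z a*_β(z)`.)
-/
theorem derivative_mode_on_vacuum
    (n : ℕ) (hn : 1 ≤ n) (I : Type) (k : ℕ) (γ : Fin k → I) (β : I)
    (m : ℤ) (hm : 0 ≤ m) :
    (∀ (r : Fin k → ℤ) (s : ℤ), (∑ i, r i) + s = m →
      (-(s : ℂ)) •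
        (((List.ofFn fun i => was (γ i) (r i)).prod * was β s) • fockVac I n) = 0) ∧
    (Function.support (fun rs : (Fin k → ℤ) × ℤ =>
        if (∑ i, rs.1 i) + rs.2 = m then
          (-(rs.2 : ℂ)) •
            (((List.ofFn fun i => was (γ i) (rs.1 i)).prod * was β rs.2) • fockVac I n)
        else 0)).Finite ∧
    (∑ᶠ rs : (Fin k → ℤ) × ℤ,
        (if (∑ i, rs.1 i) + rs.2 = m then
          (-(rs.2 : ℂ)) •
            (((List.ofFn fun i => was (γ i) (rs.1 i)).prod * was β rs.2) • fockVac I n)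
         else 0)) = 0 := by
  have hzero : ∀ (r : Fin k → ℤ) (s : ℤ), (∑ i, r i) + s = m →
      (-(s : ℂ)) •
        (((List.ofFn fun i => was (γ i) (r i)).prod * was β s) • fockVac I n) = 0 := by
    intro r s h
    rw [prod_was_mul_was_smul_fockVac hn γ β r s (h ▸ hm)]
    exact smul_zero (M := ℂ) (A := Fock I n) _
  have hfam : (fun rs : (Fin k → ℤ) × ℤ =>
      if (∑ i, rs.1 i) + rs.2 = m then
        (-(rs.2 : ℂ)) •
          (((List.ofFn fun i => was (γ i) (rs.1 i)).prod * was β rs.2) • fockVac I n)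
      else 0) = 0 := by
    ext1 rs
    exact ite_eq_right_iff.2 (hzero rs.1 rs.2)
  refine ⟨hzero, ?_, ?_⟩
  · rw [hfam, Function.support_zero]
    exact Set.finite_empty
  · rw [hfam]
    exact finsum_zero

end
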